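/- Let k ∈ ℕ and let G be a finite (k−1)-connected graph such that every pair x,y of adjacent vertices satisfies at least one of: (i) x and y have at least k−3 common neighbours; (ii) there are at least ⌊3(k−2)/2⌋ internally vertex-disjoint x–y paths in G each different from the edge xy; (iii) x and y lie together in some k-block of G. Then G has a canonical tree-decomposition of adhesion < k such that every part containing a k-block is equal to a k-block; in particular, distinct k-blocks are contained in different parts. -/

import Mathlib

open SimpleGraph Set

namespace CanonicalTD

variable {V : Type*} {ι : Type*}

/-- `p = (A,B)` is a separation of `G`: `A ∪ B = V` and no edge between `A∖B` and `B∖A`. -/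
def IsSep (G : SimpleGraph V) (p : Set V × Set V) : Prop :=
  p.1 ∪ p.2 = univ ∧ ∀ a ∈ p.1 \ p.2, ∀ b ∈ p.2 \ p.1, ¬G.Adj a b

/-- The order `|A ∩ B|` of a separation `(A,B)`. -/
noncomputable def sepOrder (p : Set V × Set V) : ℕ := (p.1 ∩ p.2).ncard

/-- A separation is proper if both `A∖B` and `B∖A` are nonempty. -/
def ProperSep (p : Set V × Set V) : Prop := (p.1 \ p.2).Nonempty ∧ (p.2 \ p.1).Nonempty

/-- The partial order on separations: `(A,B) ≤ (C,D)` iff `A ⊆ C` and `D ⊆ B`. -/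
def SepLE (p q : Set V × Set V) : Prop := p.1 ⊆ q.1 ∧ q.2 ⊆ p.2

/-- Two separations are nested if they become comparable after possibly inverting. -/
def Nested (p q : Set V × Set V) : Prop :=
  SepLE p q ∨ SepLE q p ∨ SepLE p q.swap ∨ SepLE q.swap p

/-- A separation `(A,B)` is tight if every vertex of `A ∩ B` has a neighbour in `A∖B`
and a neighbour in `B∖A`. -/
def TightSep (G : SimpleGraph V) (p : Set V × Set V) : Prop :=
  ∀ v ∈ p.1 ∩ p.2, (∃ a ∈ p.1 \ p.2, G.Adj v a) ∧ ∃ b ∈ p.2 \ p.1, G.Adj v b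

/-- `S_k`: the set of all proper separations of `G` of order `< k`. -/
def Sk (G : SimpleGraph V) (k : ℕ) : Set (Set V × Set V) :=
  {p | IsSep G p ∧ ProperSep p ∧ sepOrder p < k}

/-- A separation system of `G`: a set of separations closed under inverses. -/
def IsSepSystem (G : SimpleGraph V) (N : Set (Set V × Set V)) : Prop :=
  (∀ p ∈ N, IsSep G p) ∧ ∀ p ∈ N, p.swap ∈ N

def NestedSystem (N : Set (Set V × Set V)) : Prop :=
  ∀ p ∈ N, ∀ q ∈ N, Nested p q

def ProperSystem (N : Set (Set V × Set V)) : Prop := ∀ p ∈ N, ProperSep p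

/-- An orientation of `N`: contains exactly one of `(A,B)`, `(B,A)` for each `(A,B) ∈ N`. -/
def IsOrientation (N O : Set (Set V × Set V)) : Prop :=
  O ⊆ N ∧ ∀ p ∈ N, (p ∈ O ↔ p.swap ∉ O)

/-- Consistency: no distinct `(A,B),(C,D) ∈ O` with `(D,C) ≤ (A,B)`. -/
def Consistent (O : Set (Set V × Set V)) : Prop :=
  ∀ p ∈ O, ∀ q ∈ O, p ≠ q → ¬SepLE q.swap p

/-- A `k`-profile of `G`. -/
def IsProfile (G : SimpleGraph V) (k : ℕ) (P : Set (Set V × Set V)) : Prop :=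
  IsOrientation (Sk G k) P ∧ Consistent P ∧
    ∀ p ∈ P, ∀ q ∈ P, (p.2 ∩ q.2, p.1 ∪ q.1) ∉ P

/-- `(T, Vt)` is a tree-decomposition of `G`. -/
def IsTreeDecomp (G : SimpleGraph V) (T : SimpleGraph ι) (Vt : ι → Set V) : Prop :=
  T.IsTree ∧ (⋃ t, Vt t) = univ ∧
  (∀ u v, G.Adj u v → ∃ t, u ∈ Vt t ∧ v ∈ Vt t) ∧
  ∀ (t1 t3 : ι) (w : T.Walk t1 t3), w.IsPath →
    ∀ t2 ∈ w.support, Vt t1 ∩ Vt t3 ⊆ Vt t2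

/-- The vertex set of the component of `T - t1t2` containing `t1`. -/
def side (T : SimpleGraph ι) (t1 t2 : ι) : Set ι :=
  {s | (T.deleteEdges {s(t1, t2)}).Reachable t1 s}

/-- The separation induced by the oriented edge `(t1, t2)` of `T`. -/
def inducedSep (T : SimpleGraph ι) (Vt : ι → Set V) (t1 t2 : ι) : Set V × Set V :=
  (⋃ s ∈ side T t1 t2, Vt s, ⋃ s ∈ side T t2 t1, Vt s)

/-- The set of separations induced by oriented edges of `T`. -/
def inducedSeps (T : SimpleGraph ι) (Vt : ι → Set V) : Set (Set V × Set V) :=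
  {p | ∃ t1 t2, T.Adj t1 t2 ∧ p = inducedSep T Vt t1 t2}

/-- `O(t)`: separations induced by oriented edges `(t1,t2)` with `t` in the component of `t2`. -/
def Otow (T : SimpleGraph ι) (Vt : ι → Set V) (t : ι) : Set (Set V × Set V) :=
  {p | ∃ t1 t2, T.Adj t1 t2 ∧ t ∈ side T t2 t1 ∧ p = inducedSep T Vt t1 t2}

/-- The map assigning to each oriented edge of `T` its induced separation is a bijection
onto `N`. -/
def EdgeSepBij (T : SimpleGraph ι) (Vt : ι → Set V) (N : Set (Set V × Set V)) : Prop :=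
  (∀ t1 t2, T.Adj t1 t2 → inducedSep T Vt t1 t2 ∈ N) ∧
  ∀ p ∈ N, ∃! e : ι × ι, T.Adj e.1 e.2 ∧ inducedSep T Vt e.1 e.2 = p

/-- The tree-decomposition has adhesion `< k`. -/
def AdhesionLt (T : SimpleGraph ι) (Vt : ι → Set V) (k : ℕ) : Prop :=
  ∀ t1 t2, T.Adj t1 t2 → (Vt t1 ∩ Vt t2).ncard < k

/-- The tree-decomposition is canonical: the automorphism group of `G` acts on `T`
compatibly with the parts. -/
def Canonical (G : SimpleGraph V) (T : SimpleGraph ι) (Vt : ι → Set V) : Prop :=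
  ∃ ρ : (G ≃g G) → (T ≃g T),
    (∀ φ ψ : G ≃g G, ρ (φ.trans ψ) = (ρ φ).trans (ρ ψ)) ∧
    ∀ (φ : G ≃g G) (t : ι), (⇑φ) '' Vt t = Vt (ρ φ t)

/-- `X` is `(<k)`-inseparable in `G`. -/
def Inseparable' (G : SimpleGraph V) (k : ℕ) (X : Set V) : Prop :=
  ∀ p : Set V × Set V, IsSep G p → sepOrder p < k → X ⊆ p.1 ∨ X ⊆ p.2

/-- `X` is a `k`-block of `G`: a maximal `(<k)`-inseparable set of at least `k` vertices. -/
def IsBlock (G : SimpleGraph V) (k : ℕ) (X : Set V) : Prop :=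
  k ≤ X.ncard ∧ Inseparable' G k X ∧
    ∀ Y, Inseparable' G k Y → X ⊆ Y → Y = X

/-- The `k`-profile `P_k(X)` induced by a `k`-block `X`. -/
def blockProfile (G : SimpleGraph V) (k : ℕ) (X : Set V) : Set (Set V × Set V) :=
  {p | p ∈ Sk G k ∧ X ⊆ p.2 ∧ ¬X ⊆ p.1}

/-- `p` is a `≤`-maximal element of `M`. -/
def MaxIn (M : Set (Set V × Set V)) (p : Set V × Set V) : Prop :=
  p ∈ M ∧ ∀ q ∈ M, SepLE p q → q = p

/-- The `k`-block `X` is well separated in `S`: the maximal elements of `P_k(X) ∩ S`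
are pairwise nested. -/
def WellSepIn (G : SimpleGraph V) (k : ℕ) (X : Set V) (S : Set (Set V × Set V)) : Prop :=
  ∀ p q, MaxIn (blockProfile G k X ∩ S) p → MaxIn (blockProfile G k X ∩ S) q → Nested p q

/-- `D` is the vertex set of a component of `G - X`. -/
def IsCompOf (G : SimpleGraph V) (X D : Set V) : Prop :=
  D ⊆ Xᶜ ∧ (G.induce D).Connected ∧
    ∀ D', D ⊆ D' → D' ⊆ Xᶜ → (G.induce D').Connected → D' = D

/-- `S(X)`: the set of tight separations `(A,B)` with `X ⊆ B` and `A∖B` the vertex set of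
a component of `G - X`. -/
def SX (G : SimpleGraph V) (X : Set V) : Set (Set V × Set V) :=
  {p | IsSep G p ∧ TightSep G p ∧ X ⊆ p.2 ∧ IsCompOf G X (p.1 \ p.2)}

/-- `G` is `m`-connected. -/
def IsKConnected (G : SimpleGraph V) [Fintype V] (m : ℕ) : Prop :=
  m < Fintype.card V ∧ ∀ U : Set V, U.ncard < m → (G.induce Uᶜ).Connected

/-- The tree-decomposition distinguishes the set `Profs` of profiles. -/
def DistinguishesProfiles (T : SimpleGraph ι) (Vt : ι → Set V)
    (Profs : Set (Set (Set V × Set V))) : Prop :=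
  ∀ P ∈ Profs, ∀ P' ∈ Profs, P ≠ P' → ∃ p ∈ inducedSeps T Vt, p ∈ P ∧ p.swap ∈ P'

/-- The tree-decomposition distinguishes every two distinct `k`-blocks efficiently. -/
def DistinguishesBlocksEff (G : SimpleGraph V) (k : ℕ) (T : SimpleGraph ι)
    (Vt : ι → Set V) : Prop :=
  ∀ X X', IsBlock G k X → IsBlock G k X' → X ≠ X' →
    ∃ p ∈ inducedSeps T Vt, X ⊆ p.1 ∧ X' ⊆ p.2 ∧
      ∀ q : Set V × Set V, IsSep G q → X ⊆ q.1 → X' ⊆ q.2 → sepOrder p ≤ sepOrder q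

/-! ### The tree of consistent orientations of a nested separation system -/

/-- The orientation obtained from `o` by inverting its element `p`. -/
def flipSep (o : Set (Set V × Set V)) (p : Set V × Set V) : Set (Set V × Set V) :=
  insert p.swap (o \ {p})

/-- The consistent orientations of `N`. -/
abbrev Orientations (N : Set (Set V × Set V)) : Type _ :=
  {o : Set (Set V × Set V) // IsOrientation N o ∧ Consistent o}

lemma SepLE.swap_swap {p q : Set V × Set V} (h : SepLE p q) : SepLE q.swap p.swap :=
  ⟨h.2, h.1⟩

lemma exists_maxIn [Finite V] (M : Set (Set V × Set V)) {p : Set V × Set V} (hp : p ∈ M) :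
    ∃ q, MaxIn M q ∧ SepLE p q := by
  obtain ⟨q, hpq, hq⟩ := Set.Finite.exists_le_maximal (α := Set V × (Set V)ᵒᵈ)
    (s := M) (a := p) (Set.toFinite M) hp
  exact ⟨q, ⟨hq.prop, fun r hr hqr => (Maximal.eq_of_le (α := Set V × (Set V)ᵒᵈ) hq hr hqr).symm⟩,
    hpq⟩

lemma IsOrientation.swap_notMem {N o : Set (Set V × Set V)} (h : IsOrientation N o)
    {p : Set V × Set V} (hp : p ∈ o) : p.swap ∉ o :=
  (h.2 p (h.1 hp)).1 hp

lemma IsOrientation.swap_mem {N o : Set (Set V × Set V)} (h : IsOrientation N o)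
    {p : Set V × Set V} (hN : p ∈ N) (hp : p ∉ o) : p.swap ∈ o := by
  by_contra hs
  exact hp ((h.2 p hN).2 hs)

lemma IsOrientation.eq_of_subset {N o o' : Set (Set V × Set V)} (h : IsOrientation N o)
    (h' : IsOrientation N o') (hsub : o ⊆ o') : o = o' := by
  refine hsub.antisymm fun p hp => ?_
  by_contra hpo
  exact h'.swap_notMem hp (hsub (h.swap_mem (h'.1 hp) hpo))

/-- Consistent orientations are closed downwards. -/
lemma mem_of_sepLE {N o : Set (Set V × Set V)} (h : IsOrientation N o) (hc : Consistent o)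
    {p q : Set V × Set V} (hp : p ∈ o) (hq : q ∈ N) (hqp : q ≠ p.swap) (hle : SepLE q p) :
    q ∈ o := by
  by_contra hqo
  refine hc p hp q.swap (h.swap_mem hq hqo) ?_ hle
  rintro rfl
  exact hqp rfl

lemma flipSep_orientation {N : Set (Set V × Set V)} (hN : ∀ p ∈ N, p.swap ∈ N)
    {o : Set (Set V × Set V)} (h : IsOrientation N o) (hc : Consistent o)
    {p : Set V × Set V} (hp : MaxIn o p) :
    IsOrientation N (flipSep o p) ∧ Consistent (flipSep o p) := by
  have hps : p.swap ≠ p := fun hs => h.swap_notMem hp.1 (hs.symm ▸ hp.1)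
  refine ⟨⟨?_, fun q hq => ?_⟩, ?_⟩
  · rintro q (rfl | hq)
    · exact hN _ (h.1 hp.1)
    · exact h.1 hq.1
  · have key := h.2 q hq
    have h1 : q.swap = p.swap ↔ q = p := Prod.swap_injective.eq_iff
    have h2 : q.swap = p ↔ q = p.swap := by
      rw [← Prod.swap_injective.eq_iff, Prod.swap_swap]
    simp only [flipSep, mem_insert_iff, mem_sdiff, mem_singleton_iff, h1, h2]
    by_cases e1 : q = p
    · subst e1
      simp [hps.symm]
    · by_cases e2 : q = p.swap
      · simp [e2, hps]
      · simp [e1, e2, key]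
  · rintro a (rfl | ha) b (rfl | hb) hab hle
    · exact hab rfl
    · exact hb.2 (hp.2 b hb.1 hle.swap_swap)
    · exact ha.2 (hp.2 a ha.1 hle)
    · exact hc a ha.1 b hb.1 hab hle

section OrientationTree

variable {N : Set (Set V × Set V)} (e : ι ≃ Orientations N)

/-- The graph on the consistent orientations of `N`, two of which are adjacent if they differ
in exactly one separation. -/
def orientationTree (e : ι ≃ Orientations N) : SimpleGraph ι where
  Adj s t := ∃ p ∈ (e s).1, p ∉ (e t).1 ∧
    ∀ q, q ≠ p → q ≠ p.swap → (q ∈ (e s).1 ↔ q ∈ (e t).1)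
  symm := ⟨by
    rintro s t ⟨p, hs, ht, h⟩
    have hpN := (e s).2.1.1 hs
    refine ⟨p.swap, (e t).2.1.swap_mem hpN ht, (e s).2.1.swap_notMem hs, fun q h1 h2 => ?_⟩
    exact (h q (by simpa using h2) h1).symm⟩
  loopless := ⟨by
    rintro s ⟨p, hs, ht, -⟩
    exact ht hs⟩

/-- The part of the tree-decomposition at a consistent orientation. -/
def orientationPart (e : ι ≃ Orientations N) (t : ι) : Set V := {v | ∀ p ∈ (e t).1, v ∈ p.2}

variable {e}

lemma orientationTree_adj_iff {a b : ι} (h : (orientationTree e).Adj a b)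
    {p : Set V × Set V} (ha : p ∈ (e a).1) (hb : p ∉ (e b).1) {q : Set V × Set V}
    (h1 : q ≠ p) (h2 : q ≠ p.swap) : q ∈ (e a).1 ↔ q ∈ (e b).1 := by
  obtain ⟨r, hra, hrb, hr⟩ := h
  obtain rfl : p = r := by
    by_contra hpr
    refine hb ((hr p hpr ?_).1 ha)
    rintro rfl
    exact (e a).2.1.swap_notMem hra ha
  exact hr q h1 h2

lemma orientationTree_tail_unique (hN : ∀ p ∈ N, p.swap ∈ N) (hnest : NestedSystem N) {a b a' b' : ι}
    (h : (orientationTree e).Adj a b) (h' : (orientationTree e).Adj a' b')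
    {p : Set V × Set V} (ha : p ∈ (e a).1) (hb : p ∉ (e b).1)
    (ha' : p ∈ (e a').1) (hb' : p ∉ (e b').1) : a = a' := by
  have hpN := (e a).2.1.1 ha
  refine e.injective (Subtype.ext ((e a).2.1.eq_of_subset (e a').2.1 fun q hq => ?_))
  have hqN := (e a).2.1.1 hq
  by_cases h1 : q = p
  · exact h1 ▸ ha'
  have h2 : q ≠ p.swap := by
    rintro rfl
    exact (e a).2.1.swap_notMem ha hq
  have h1s : q.swap ≠ p.swap := fun hs => h1 (Prod.swap_injective hs)
  have h2s : q.swap ≠ p := fun hs => h2 (by rw [← hs, Prod.swap_swap])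
  have hqa := orientationTree_adj_iff h ha hb h1 h2
  have hqa' := orientationTree_adj_iff h' ha' hb' h1 h2
  rcases hnest p hpN q hqN with hle | hle | hle | hle
  · refine absurd (mem_of_sepLE (e b).2.1 (e b).2.2 ((e b).2.1.swap_mem hpN hb)
      (hN q hqN) (by simpa using h2s) hle.swap_swap) ((e b).2.1.swap_notMem (hqa.1 hq))
  · exact mem_of_sepLE (e a').2.1 (e a').2.2 ha' hqN h2 hle
  · exact hqa'.2 (mem_of_sepLE (e b').2.1 (e b').2.2 ((e b').2.1.swap_mem hpN hb') hqN
      (by simpa using h1) (by simpa using hle.swap_swap))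
  · exact absurd (mem_of_sepLE (e a).2.1 (e a).2.2 ha (hN q hqN) h1s hle)
      ((e a).2.1.swap_notMem hq)

lemma orientationTree_edge_unique (hN : ∀ p ∈ N, p.swap ∈ N) (hnest : NestedSystem N) {a b a' b' : ι}
    (h : (orientationTree e).Adj a b) (h' : (orientationTree e).Adj a' b')
    {p : Set V × Set V} (ha : p ∈ (e a).1) (hb : p ∉ (e b).1)
    (ha' : p ∈ (e a').1) (hb' : p ∉ (e b').1) : a = a' ∧ b = b' := by
  have hpN := (e a).2.1.1 ha
  exact ⟨orientationTree_tail_unique hN hnest h h' ha hb ha' hb',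
    orientationTree_tail_unique hN hnest h.symm h'.symm ((e b).2.1.swap_mem hpN hb)
      ((e a).2.1.swap_notMem ha) ((e b').2.1.swap_mem hpN hb') ((e a').2.1.swap_notMem ha')⟩

lemma exists_edge_of_walk {s t : ι} (w : (orientationTree e).Walk s t)
    {p : Set V × Set V} (hs : p ∈ (e s).1) (ht : p ∉ (e t).1) :
    ∃ a b, (orientationTree e).Adj a b ∧ s(a, b) ∈ w.edges ∧ p ∈ (e a).1 ∧ p ∉ (e b).1 := by
  obtain ⟨d, hd, h1, h2⟩ := w.exists_boundary_dart {a | p ∈ (e a).1} hs ht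
  exact ⟨d.fst, d.snd, d.adj, List.mem_map.2 ⟨d, hd, rfl⟩, h1, h2⟩

/-- From an orientation one can move along an edge inverting any maximal element. -/
lemma exists_adj_flipSep (hN : ∀ p ∈ N, p.swap ∈ N) (t : ι) {p : Set V × Set V} (hp : MaxIn (e t).1 p) :
    ∃ s, (orientationTree e).Adj t s ∧ (e s).1 = flipSep (e t).1 p := by
  refine ⟨e.symm ⟨_, flipSep_orientation hN (e t).2.1 (e t).2.2 hp⟩, ?_, by simp⟩
  have hps : p ≠ p.swap := fun hs => (e t).2.1.swap_notMem hp.1 (hs ▸ hp.1)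
  refine ⟨p, hp.1, by simp [flipSep, hps], fun q h1 h2 => by simp [flipSep, h1, h2]⟩

lemma orientationTree_reachable [Finite V] (hN : ∀ p ∈ N, p.swap ∈ N) (s t : ι) :
    (orientationTree e).Reachable s t := by
  induction hn : ((e s).1 \ (e t).1).ncard using Nat.strong_induction_on generalizing s with
  | _ n ih =>
  by_cases hst : (e s).1 ⊆ (e t).1
  · obtain rfl : s = t :=
      e.injective (Subtype.ext ((e s).2.1.eq_of_subset (e t).2.1 hst))
    exact .refl _
  obtain ⟨p₀, hp₀s, hp₀t⟩ := Set.not_subset.1 hst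
  obtain ⟨p, hp, -⟩ := exists_maxIn ((e s).1 \ (e t).1) ⟨hp₀s, hp₀t⟩
  have hpt := (e t).2.1.swap_mem ((e s).2.1.1 hp.1.1) hp.1.2
  have hmax : MaxIn (e s).1 p := by
    refine ⟨hp.1.1, fun q hq hpq => hp.2 q ⟨hq, fun hqt => ?_⟩ hpq⟩
    refine (e t).2.2 p.swap hpt q hqt ?_ hpq.swap_swap
    rintro rfl
    exact (e s).2.1.swap_notMem hp.1.1 hq
  obtain ⟨s', hadj, hs'⟩ := exists_adj_flipSep hN s hmax
  refine hadj.reachable.trans (ih _ ?_ s' rfl)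
  rw [← hn, hs']
  refine Set.ncard_lt_ncard (Set.ssubset_iff_of_subset ?_ |>.2 ⟨p, hp.1, ?_⟩)
  · rintro q ⟨rfl | hq, hqt⟩
    · exact absurd hpt hqt
    · exact ⟨hq.1, hqt⟩
  · rintro ⟨rfl' | hq, -⟩
    · exact (e s).2.1.swap_notMem hp.1.1 (rfl' ▸ hp.1.1)
    · exact hq.2 rfl

lemma orientationTree_isTree [Finite V] [Nonempty ι] (hN : ∀ p ∈ N, p.swap ∈ N)
    (hnest : NestedSystem N) :
    (orientationTree e).IsTree := by
  refine ⟨⟨orientationTree_reachable hN⟩, isAcyclic_iff_forall_adj_isBridge.2 fun a b hab => ?_⟩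
  refine isBridge_iff_forall_walk_mem_edges.2 fun w => ?_
  obtain ⟨p, ha, hb, -⟩ := id hab
  obtain ⟨c, d, hcd, hmem, hc, hd⟩ := exists_edge_of_walk w ha hb
  obtain ⟨rfl, rfl⟩ := orientationTree_edge_unique hN hnest hab hcd ha hb hc hd
  exact hmem

/-- A set contained in one side of every separation of `N` lies in some part. -/
lemma exists_subset_orientationPart [Finite V] [Nonempty ι] (hN : ∀ p ∈ N, p.swap ∈ N)
    {S : Set V} (hS : ∀ p ∈ N, S ⊆ p.1 ∨ S ⊆ p.2) : ∃ t, S ⊆ orientationPart e t := by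
  suffices h : ∀ (n : ℕ) (t : ι), {p ∈ (e t).1 | ¬S ⊆ p.2}.ncard = n →
      ∃ t, S ⊆ orientationPart e t from h _ (Classical.arbitrary ι) rfl
  intro n
  induction n using Nat.strong_induction_on with
  | _ n ih =>
  intro t hn
  by_cases ht : S ⊆ orientationPart e t
  · exact ⟨t, ht⟩
  obtain ⟨v, hv, hvt⟩ := Set.not_subset.1 ht
  simp only [orientationPart, mem_ofPred_eq, not_forall] at hvt
  obtain ⟨p₀, hp₀, hvp₀⟩ := hvt
  obtain ⟨p, hp, -⟩ := exists_maxIn {p ∈ (e t).1 | ¬S ⊆ p.2} ⟨hp₀, fun h => hvp₀ (h hv)⟩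
  have hmax : MaxIn (e t).1 p :=
    ⟨hp.1.1, fun q hq hpq => hp.2 q ⟨hq, fun h => hp.1.2 (h.trans hpq.2)⟩ hpq⟩
  obtain ⟨s, -, hs⟩ := exists_adj_flipSep hN t hmax
  refine ih _ ?_ s rfl
  rw [← hn, hs]
  refine Set.ncard_lt_ncard (Set.ssubset_iff_of_subset ?_ |>.2 ⟨p, hp.1, ?_⟩)
  · rintro q ⟨rfl | hq, hqS⟩
    · exact absurd ((hS p ((e t).2.1.1 hp.1.1)).resolve_right hp.1.2) hqS
    · exact ⟨hq.1, hqS⟩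
  · rintro ⟨h | hq, -⟩
    · exact (e t).2.1.swap_notMem hp.1.1 (h ▸ hp.1.1)
    · exact hq.2 rfl

lemma orientationPart_inter_subset (hN : ∀ p ∈ N, p.swap ∈ N) (hnest : NestedSystem N) {s t : ι}
    (w : (orientationTree e).Walk s t) (hw : w.IsPath) {r : ι} (hr : r ∈ w.support) :
    orientationPart e s ∩ orientationPart e t ⊆ orientationPart e r := by
  classical
  rintro v ⟨hs, ht⟩ p hp
  by_cases hps : p ∈ (e s).1
  · exact hs p hps
  by_cases hpt : p ∈ (e t).1
  · exact ht p hpt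
  obtain ⟨a, b, hab, hmem, ha, hb⟩ := exists_edge_of_walk (w.dropUntil r hr) hp hpt
  obtain ⟨c, d, hcd, hmem', hc, hd⟩ := exists_edge_of_walk (w.takeUntil r hr).reverse hp hps
  obtain ⟨rfl, rfl⟩ := orientationTree_edge_unique hN hnest hab hcd ha hb hc hd
  rw [Walk.edges_reverse, List.mem_reverse] at hmem'
  exact absurd hmem (hw.isTrail.disjoint_edges_takeUntil_dropUntil hr hmem')

lemma orientationTree_isTreeDecomp [Finite V] [Nonempty ι] {G : SimpleGraph V}
    (hN : ∀ p ∈ N, p.swap ∈ N) (hsep : ∀ p ∈ N, IsSep G p) (hnest : NestedSystem N) :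
    IsTreeDecomp G (orientationTree e) (orientationPart e) := by
  refine ⟨orientationTree_isTree hN hnest, eq_univ_of_forall fun v => ?_, fun u v huv => ?_,
    fun s t w hw r hr => orientationPart_inter_subset hN hnest w hw hr⟩
  · obtain ⟨t, ht⟩ := exists_subset_orientationPart (e := e) hN (S := {v}) fun p hp => by
      have : v ∈ p.1 ∪ p.2 := (hsep p hp).1 ▸ mem_univ v
      simpa using this
    exact mem_iUnion.2 ⟨t, ht rfl⟩
  · obtain ⟨t, ht⟩ := exists_subset_orientationPart (e := e) hN (S := {u, v}) fun p hp => by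
      have hu : u ∈ p.1 ∪ p.2 := (hsep p hp).1 ▸ mem_univ u
      have hv : v ∈ p.1 ∪ p.2 := (hsep p hp).1 ▸ mem_univ v
      have h1 := (hsep p hp).2 u
      have h2 := (hsep p hp).2 v
      have := huv.symm
      simp only [insert_subset_iff, singleton_subset_iff]
      grind
    exact ⟨t, ht (by simp), ht (by simp)⟩

lemma orientationTree_adhesionLt [Finite V] {k : ℕ} (hk : ∀ p ∈ N, sepOrder p < k) :
    AdhesionLt (orientationTree e) (orientationPart e) k := by
  rintro s t ⟨p, hs, ht, -⟩
  have hpN := (e s).2.1.1 hs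
  refine (Set.ncard_le_ncard ?_).trans_lt (hk p hpN)
  rintro v ⟨hvs, hvt⟩
  exact ⟨hvt _ ((e t).2.1.swap_mem hpN ht), hvs p hs⟩

end OrientationTree

/-! ### The action of automorphisms -/

/-- The image of a pair of vertex sets under a map. -/
def sepMap (f : V → V) (p : Set V × Set V) : Set V × Set V := (f '' p.1, f '' p.2)

section Automorphisms

variable {G : SimpleGraph V}

lemma sepMap_symm_sepMap (φ : G ≃g G) (p : Set V × Set V) :
    sepMap φ.symm (sepMap φ p) = p := by
  simp [sepMap, Set.image_image]

lemma sepMap_sepMap_symm (φ : G ≃g G) (p : Set V × Set V) :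
    sepMap φ (sepMap φ.symm p) = p := by
  simp [sepMap, Set.image_image]

lemma sepMap_injective (φ : G ≃g G) : Function.Injective (sepMap φ) :=
  Function.LeftInverse.injective (sepMap_symm_sepMap φ)

lemma sepMap_swap (f : V → V) (p : Set V × Set V) : sepMap f p.swap = (sepMap f p).swap := rfl

lemma sepLE_sepMap (φ : G ≃g G) {p q : Set V × Set V} :
    SepLE (sepMap φ p) (sepMap φ q) ↔ SepLE p q := by
  simp only [SepLE, sepMap, Set.image_subset_image_iff φ.injective]

variable {N : Set (Set V × Set V)}

lemma image_sepMap_orientation (hinv : ∀ (φ : G ≃g G), ∀ p ∈ N, sepMap φ p ∈ N) (φ : G ≃g G)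
    {o : Set (Set V × Set V)} (h : IsOrientation N o ∧ Consistent o) :
    IsOrientation N (sepMap φ '' o) ∧ Consistent (sepMap φ '' o) := by
  refine ⟨⟨?_, fun p hp => ?_⟩, ?_⟩
  · rintro _ ⟨p, hp, rfl⟩
    exact hinv φ p (h.1.1 hp)
  · obtain ⟨q, rfl⟩ : ∃ q, sepMap φ q = p := ⟨_, sepMap_sepMap_symm φ p⟩
    have hq : q ∈ N := sepMap_symm_sepMap φ q ▸ hinv φ.symm _ hp
    rw [← sepMap_swap, (sepMap_injective φ).mem_set_image, (sepMap_injective φ).mem_set_image]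
    exact h.1.2 q hq
  · rintro _ ⟨p, hp, rfl⟩ _ ⟨q, hq, rfl⟩ hne hle
    exact h.2 p hp q hq (fun h => hne (h ▸ rfl)) ((sepLE_sepMap φ).1 hle)

/-- An automorphism acts on the consistent orientations. -/
def orientationMap (hinv : ∀ (φ : G ≃g G), ∀ p ∈ N, sepMap φ p ∈ N) (φ : G ≃g G)
    (o : Orientations N) : Orientations N :=
  ⟨sepMap φ '' o.1, image_sepMap_orientation hinv φ o.2⟩

/-- The action of an automorphism of `G` on the tree of consistent orientations. -/
def orientationIso (e : ι ≃ Orientations N)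
    (hinv : ∀ (φ : G ≃g G), ∀ p ∈ N, sepMap φ p ∈ N) (φ : G ≃g G) :
    orientationTree e ≃g orientationTree e where
  toFun t := e.symm (orientationMap hinv φ (e t))
  invFun t := e.symm (orientationMap hinv φ.symm (e t))
  left_inv t := by
    simp [orientationMap, Set.image_image, sepMap_symm_sepMap]
  right_inv t := by
    simp [orientationMap, Set.image_image, sepMap_sepMap_symm]
  map_rel_iff' {s t} := by
    have hinj := sepMap_injective φ
    have hsurj : Function.Surjective (sepMap φ) := fun p => ⟨_, sepMap_sepMap_symm φ p⟩
    have hmem (r : ι) (p : Set V × Set V) :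
        sepMap φ p ∈ (e (e.symm (orientationMap hinv φ (e r)))).1 ↔ p ∈ (e r).1 := by
      rw [e.apply_symm_apply]
      exact hinj.mem_set_image
    refine hsurj.exists.trans (exists_congr fun p => and_congr (hmem s p) (and_congr
      (hmem t p).not (hsurj.forall.trans (forall_congr' fun q => ?_))))
    rw [← sepMap_swap, hinj.ne_iff, hinj.ne_iff]
    exact imp_congr_right fun _ => imp_congr_right fun _ => iff_congr (hmem s q) (hmem t q)

lemma orientationTree_canonical (e : ι ≃ Orientations N)
    (hinv : ∀ (φ : G ≃g G), ∀ p ∈ N, sepMap φ p ∈ N) :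
    Canonical G (orientationTree e) (orientationPart e) := by
  refine ⟨orientationIso e hinv, fun φ ψ => ?_, fun φ t => ?_⟩
  · ext t
    simp [orientationIso, orientationMap, Set.image_image, sepMap, Function.comp_def]
    rfl
  · ext v
    obtain ⟨u, rfl⟩ := φ.surjective v
    rw [φ.injective.mem_set_image]
    have : (e (orientationIso e hinv φ t)).1 = sepMap φ '' (e t).1 := by
      simp [orientationIso, orientationMap]
    simp only [orientationPart, mem_ofPred_eq, this, Set.forall_mem_image, sepMap,
      φ.injective.mem_set_image]

end Automorphisms

/-! ### Separations of highly connected graphs -/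

section Separations

variable {G : SimpleGraph V} {k : ℕ} {p q : Set V × Set V}

lemma IsSep.mem_or (h : IsSep G p) (v : V) : v ∈ p.1 ∨ v ∈ p.2 :=
  (h.1 ▸ mem_univ v : v ∈ p.1 ∪ p.2)

lemma IsSep.mem_of_adj (h : IsSep G p) {u v : V} (hu : u ∈ p.1) (hu' : u ∉ p.2)
    (huv : G.Adj u v) : v ∈ p.1 := by
  by_contra hv
  exact h.2 u ⟨hu, hu'⟩ v ⟨(h.mem_or v).resolve_left hv, hv⟩ huv

lemma isSep_of_mem (h1 : ∀ v, v ∈ p.1 ∨ v ∈ p.2)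
    (h2 : ∀ u v, u ∈ p.1 → u ∉ p.2 → G.Adj u v → v ∈ p.1) : IsSep G p :=
  ⟨eq_univ_of_forall h1, fun u hu v hv huv => hv.2 (h2 u v hu.1 hu.2 huv)⟩

lemma IsSep.swap (h : IsSep G p) : IsSep G p.swap :=
  ⟨by rw [← h.1]; exact union_comm _ _, fun a ha b hb hab => h.2 b hb a ha hab.symm⟩

lemma sepOrder_swap (p : Set V × Set V) : sepOrder p.swap = sepOrder p := by
  simp [sepOrder, inter_comm]

lemma IsSep.corner (hp : IsSep G p) (hq : IsSep G q) : IsSep G (p.1 ∩ q.1, p.2 ∪ q.2) := by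
  refine isSep_of_mem (fun v => ?_) fun u v hu hu' huv => ?_
  · have := hp.mem_or v
    have := hq.mem_or v
    simp only [mem_inter_iff, mem_union]
    tauto
  · simp only [mem_union, not_or] at hu'
    exact ⟨hp.mem_of_adj hu.1 hu'.1 huv, hq.mem_of_adj hu.2 hu'.2 huv⟩

variable [Fintype V]

lemma IsKConnected.le_sepOrder {m : ℕ} (hconn : IsKConnected G m) (hs : IsSep G p)
    (hp : ProperSep p) : m ≤ sepOrder p := by
  by_contra! hlt
  obtain ⟨⟨a, ha⟩, b, hb⟩ := hp
  obtain ⟨w⟩ := (hconn.2 (p.1 ∩ p.2) hlt).preconnected ⟨a, fun h => ha.2 h.2⟩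
    ⟨b, fun h => hb.2 h.1⟩
  obtain ⟨d, -, h1, h2⟩ := w.exists_boundary_dart {x | x.1 ∈ p.1} ha.1 hb.2
  exact h2 (hs.mem_of_adj h1 (fun h => d.fst.2 ⟨h1, h⟩) d.adj)

lemma IsKConnected.exists_adj (hconn : IsKConnected G (k - 1)) (hs : IsSep G p)
    (hp : ProperSep p) (hk : sepOrder p < k) {x : V} (hx : x ∈ p.1 ∩ p.2) :
    ∃ y ∈ p.1 \ p.2, G.Adj x y := by
  by_contra! hno
  have hle := hconn.le_sepOrder (p := (p.1 \ {x}, p.2)) ?_ ?_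
  · have hlt : sepOrder (p.1 \ {x}, p.2) < sepOrder p := by
      refine Set.ncard_lt_ncard (Set.ssubset_iff_of_subset ?_ |>.2 ⟨x, hx, fun h => h.1.2 rfl⟩)
      exact fun v hv => ⟨hv.1.1, hv.2⟩
    omega
  · refine isSep_of_mem (fun v => ?_) fun u v hu hu' huv => ⟨hs.mem_of_adj hu.1 hu' huv, ?_⟩
    · by_cases hv : v = x
      · exact Or.inr (hv ▸ hx.2)
      · exact (hs.mem_or v).imp (fun h => ⟨h, hv⟩) id
    · rintro rfl
      exact hno u ⟨hu.1, hu'⟩ huv.symm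
  · obtain ⟨⟨a, ha⟩, b, hb⟩ := hp
    refine ⟨⟨a, ⟨ha.1, ?_⟩, ha.2⟩, b, hb.1, fun h => hb.2 h.1⟩
    rintro rfl
    exact ha.2 hx.2

end Separations

/-! ### The separations cut off by components of the complement of a block -/

section Petals

variable {G : SimpleGraph V} {k : ℕ} {p q : Set V × Set V} {X Y : Set V}

/-- `p` is a separation of order less than `k` whose separator is contained in `X` such that
`p.1 \ p.2` is a component of `G - X` with neighbourhood `p.1 ∩ p.2`. -/
structure IsPetal (G : SimpleGraph V) (k : ℕ) (X : Set V) (p : Set V × Set V) : Prop where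
  isSep : IsSep G p
  order_lt : sepOrder p < k
  subset_right : X ⊆ p.2
  inter_subset : p.1 ∩ p.2 ⊆ X
  exists_adj : ∀ v ∈ p.1 ∩ p.2, ∃ a ∈ p.1 \ p.2, G.Adj v a
  nonempty : (p.1 \ p.2).Nonempty
  connected : ∀ S : Set V, (S ∩ (p.1 \ p.2)).Nonempty →
    (∀ a ∈ S, ∀ b, a ∈ p.1 \ p.2 → b ∈ p.1 \ p.2 → G.Adj a b → b ∈ S) → p.1 \ p.2 ⊆ S

lemma IsPetal.subset_or (hp : IsPetal G k X p) (hq : IsSep G q)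
    (hd : ∀ v ∈ p.1 \ p.2, v ∉ q.1 ∩ q.2) : p.1 \ p.2 ⊆ q.1 \ q.2 ∨ p.1 \ p.2 ⊆ q.2 \ q.1 := by
  have key : ∀ q : Set V × Set V, IsSep G q → (∀ v ∈ p.1 \ p.2, v ∉ q.1 ∩ q.2) →
      ((p.1 ∩ q.1) \ p.2).Nonempty → p.1 \ p.2 ⊆ q.1 \ q.2 := by
    rintro q hq hd ⟨a, ha, hap⟩
    refine hp.connected _ ⟨a, ⟨ha.2, fun h => hd a ⟨ha.1, hap⟩ ⟨ha.2, h⟩⟩, ha.1, hap⟩ ?_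
    intro b hb c _ hc hbc
    have := hq.mem_of_adj hb.1 hb.2 hbc
    exact ⟨this, fun h => hd c hc ⟨this, h⟩⟩
  obtain ⟨a, ha⟩ := hp.nonempty
  rcases hq.mem_or a with h | h
  · exact Or.inl (key q hq hd ⟨a, ⟨ha.1, h⟩, ha.2⟩)
  · exact Or.inr (key q.swap hq.swap (fun v hv hvq => hd v hv hvq.symm) ⟨a, ⟨ha.1, h⟩, ha.2⟩)

lemma IsPetal.sepLE_of_subset (hp : IsPetal G k X p) (hq : IsSep G q)
    (hpq : p.1 \ p.2 ⊆ q.1 \ q.2) : SepLE p q := by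
  refine ⟨fun v hv => ?_, fun v hv => ?_⟩
  · by_cases h : v ∈ p.2
    · obtain ⟨a, ha, hva⟩ := hp.exists_adj v ⟨hv, h⟩
      exact hq.mem_of_adj (hpq ha).1 (hpq ha).2 hva.symm
    · exact (hpq ⟨hv, h⟩).1
  · by_contra h
    exact (hpq ⟨(hp.isSep.mem_or v).resolve_right h, h⟩).2 hv

lemma sepLE_swap_of_subset (hp : IsSep G p) (hpq : p.1 ∩ p.2 ⊆ q.2)
    (h : p.1 \ p.2 ⊆ q.2 \ q.1) : SepLE p q.swap := by
  refine ⟨fun v hv => ?_, fun v hv => ?_⟩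
  · by_cases hv2 : v ∈ p.2
    · exact hpq ⟨hv, hv2⟩
    · exact (h ⟨hv, hv2⟩).1
  · by_contra hv2
    exact (h ⟨(hp.mem_or v).resolve_right hv2, hv2⟩).2 hv

lemma IsPetal.nested_of_subset_right (hp : IsPetal G k X p) (hq : IsPetal G k Y q)
    (hX : X ⊆ q.2) (hY : Y ⊆ p.2) : Nested p q := by
  have hpq := hp.inter_subset.trans hX
  have hqp := hq.inter_subset.trans hY
  rcases hp.subset_or hq.isSep fun v hv hvq => hv.2 (hqp hvq) with h | h
  · exact Or.inl (hp.sepLE_of_subset hq.isSep h)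
  · exact Or.inr (Or.inr (Or.inl (sepLE_swap_of_subset hp.isSep hpq h)))

lemma IsPetal.nested_of_subset_left (hp : IsPetal G k X p) (hq : IsPetal G k Y q)
    (hX : X ⊆ q.2) (hY : Y ⊆ p.1) : Nested p q := by
  have hpq := hp.inter_subset.trans hX
  have hqp := hq.inter_subset.trans hY
  have hmem := hq.isSep.mem_or
  rcases hq.subset_or hp.isSep fun v hv hvp => hv.2 (hpq hvp) with h | h
  · refine Or.inr (Or.inl ⟨fun v hv => ?_, fun v hv => ?_⟩)
    · by_cases hv2 : v ∈ q.2
      · exact hqp ⟨hv, hv2⟩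
      · exact (h ⟨hv, hv2⟩).1
    · by_contra hv2
      exact (h ⟨(hmem v).resolve_right hv2, hv2⟩).2 hv
  · have hqp2 : q.1 ∩ q.2 ⊆ p.2 := by
      intro v hv
      obtain ⟨a, ha, hva⟩ := hq.exists_adj v hv
      exact hp.isSep.swap.mem_of_adj (h ha).1 (h ha).2 hva.symm
    refine Or.inr (Or.inr (Or.inl ⟨fun v hv => ?_, fun v hv => ?_⟩))
    · by_contra hv2
      exact (h ⟨(hmem v).resolve_right hv2, hv2⟩).2 hv
    · by_cases hv2 : v ∈ q.2
      · exact hqp2 ⟨hv, hv2⟩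
      · exact (h ⟨hv, hv2⟩).1

lemma Nested.symm (h : Nested p q) : Nested q p := by
  rcases h with h | h | h | h
  · exact Or.inr (Or.inl h)
  · exact Or.inl h
  · exact Or.inr (Or.inr (Or.inl h.swap_swap))
  · exact Or.inr (Or.inr (Or.inr h.swap_swap))

lemma Nested.swap_left (h : Nested p q) : Nested p.swap q := by
  rcases h with h | h | h | h
  · exact Or.inr (Or.inr (Or.inr h.swap_swap))
  · exact Or.inr (Or.inr (Or.inl h.swap_swap))
  · exact Or.inr (Or.inl h.swap_swap)
  · exact Or.inl h.swap_swap

/-- The separations of `G` cut off by components of complements of `k`-blocks, together with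
their inverses. -/
def petalSystem (G : SimpleGraph V) (k : ℕ) : Set (Set V × Set V) :=
  {p | ∃ X, IsBlock G k X ∧ (IsPetal G k X p ∨ IsPetal G k X p.swap)}

lemma swap_mem_petalSystem (hp : p ∈ petalSystem G k) : p.swap ∈ petalSystem G k := by
  obtain ⟨X, hX, h⟩ := hp
  exact ⟨X, hX, h.symm⟩

lemma isSep_of_mem_petalSystem (hp : p ∈ petalSystem G k) : IsSep G p := by
  obtain ⟨X, -, h | h⟩ := hp
  exacts [h.isSep, h.isSep.swap]

lemma sepOrder_lt_of_mem_petalSystem (hp : p ∈ petalSystem G k) : sepOrder p < k := by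
  obtain ⟨X, -, h | h⟩ := hp
  exacts [h.order_lt, sepOrder_swap p ▸ h.order_lt]

end Petals

/-! ### Maximal separations in the profile of a block -/

section Profiles

variable {G : SimpleGraph V} {k : ℕ} {p q : Set V × Set V} {X : Set V}

/-- A path of length at least two that starts in `q.1 \ q.2` and meets the separator of `q` only
in its last vertex reaches it from another vertex of `q.1 \ q.2`. -/
lemma exists_mem_support_adj (hq : IsSep G q) {u y : V} (w : G.Walk u y) (hw : w.IsPath)
    (hu : u ∈ q.1 \ q.2) (hy : y ∈ q.2) (havoid : ∀ v ∈ w.support, v ≠ y → v ∉ q.1 ∩ q.2) :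
    ∃ z ∈ w.support, z ∈ q.1 \ q.2 ∧ G.Adj z y ∧ (2 ≤ w.length → z ≠ u) := by
  induction w with
  | nil => exact absurd hy hu.2
  | @cons u v y h w ih =>
    by_cases hvy : v = y
    · subst hvy
      have hnil := Walk.isPath_iff_nil.1 ((Walk.cons_isPath_iff h w).1 hw).1
      exact ⟨u, by simp, hu, h, by simp [Walk.length_eq_zero_iff.2 hnil]⟩
    · have hv1 := hq.mem_of_adj hu.1 hu.2 h
      have hv2 : v ∉ q.2 := fun h2 => havoid v (by simp) hvy ⟨hv1, h2⟩
      obtain ⟨z, hz, hzq, hzy, -⟩ := ih ((Walk.cons_isPath_iff h w).1 hw).1 ⟨hv1, hv2⟩ hy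
        fun x hx => havoid x (by simp [hx])
      refine ⟨z, by simp [hz], hzq, hzy, fun _ => ?_⟩
      rintro rfl
      exact ((Walk.cons_isPath_iff h w).1 hw).2 hz

/-- If the corner of `p` and `q` has empty interior, every path of length at least two from
`q.1 \ q.2` to a vertex of `p.1 \ p.2` in the separator of `q` meets the separator of `q` or the
link of `p` in `q.1` in an inner vertex. -/
lemma exists_inner_vertex (hp : IsSep G p) (hq : IsSep G q)
    (hcorner : ∀ v ∈ p.1, v ∈ q.1 → v ∈ p.2 ∨ v ∈ q.2) {x y : V} (hx : x ∈ q.1 \ q.2)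
    (hy : y ∈ p.1 \ p.2) (hyq : y ∈ q.2) (w : G.Walk x y) (hw : w.IsPath) (hlen : 2 ≤ w.length) :
    ∃ v ∈ w.support, v ≠ x ∧ v ≠ y ∧ v ∈ q.1 ∩ (q.2 ∪ p.1 ∩ p.2) := by
  by_cases havoid : ∀ v ∈ w.support, v ≠ y → v ∉ q.1 ∩ q.2
  · obtain ⟨z, hz, hzq, hzy, hzx⟩ := exists_mem_support_adj hq w hw hx hyq havoid
    have hzp := hp.mem_of_adj hy.1 hy.2 hzy.symm
    exact ⟨z, hz, hzx hlen, hzy.ne, hzq.1,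
      Or.inr ⟨hzp, (hcorner z hzp hzq.1).resolve_right hzq.2⟩⟩
  · push Not at havoid
    obtain ⟨v, hv, hvy, hvq⟩ := havoid
    refine ⟨v, hv, ?_, hvy, hvq.1, Or.inl hvq.2⟩
    rintro rfl
    exact hx.2 hvq.2

/-- Internally disjoint paths with chosen inner vertices in `S` are at most `|S| - 2` many. -/
lemma card_paths_add_two_le [Finite V] {n : ℕ} {x y : V} (hxy : x ≠ y)
    (Ps : Fin n → G.Walk x y)
    (hdisj : ∀ i j, i ≠ j → ∀ v ∈ (Ps i).support, v ∈ (Ps j).support → v = x ∨ v = y)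
    {S : Set V} (hxS : x ∈ S) (hyS : y ∈ S)
    (hS : ∀ i, ∃ v ∈ (Ps i).support, v ≠ x ∧ v ≠ y ∧ v ∈ S) : n + 2 ≤ S.ncard := by
  choose f hf hfx hfy hfS using hS
  have hinj : Function.Injective f := by
    intro i j hij
    by_contra hne
    rcases hdisj i j hne (f i) (hf i) (hij ▸ hf j) with h | h
    · exact hfx i h
    · exact hfy i h
  have hsub : Set.range f ∪ {x, y} ⊆ S := by
    rintro v (⟨i, rfl⟩ | rfl | rfl)
    exacts [hfS i, hxS, hyS]
  have hd : Disjoint (Set.range f) {x, y} := by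
    rw [Set.disjoint_left]
    rintro _ ⟨i, rfl⟩ (h | h)
    · exact hfx i h
    · exact hfy i h
  calc n + 2 = (Set.range f).ncard + ({x, y} : Set V).ncard := by
        rw [Set.ncard_pair hxy, ← Set.image_univ, Set.ncard_image_of_injective _ hinj]
        simp
    _ = (Set.range f ∪ {x, y}).ncard := (Set.ncard_union_eq hd).symm
    _ ≤ S.ncard := Set.ncard_le_ncard hsub

/-- The local conditions on an adjacent pair of vertices. -/
def LocallyLinked (G : SimpleGraph V) (k : ℕ) (x y : V) : Prop :=
  (k - 3 ≤ {z : V | G.Adj x z ∧ G.Adj y z}.ncard) ∨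
  (∃ Ps : Fin (3 * (k - 2) / 2) → G.Walk x y,
    (∀ i, (Ps i).IsPath) ∧ (∀ i, 2 ≤ (Ps i).length) ∧
    ∀ i j, i ≠ j → ∀ v ∈ (Ps i).support, v ∈ (Ps j).support → v = x ∨ v = y) ∨
  (∃ X : Set V, IsBlock G k X ∧ x ∈ X ∧ y ∈ X)

variable [Fintype V]

lemma IsBlock.not_subset_inter (hX : IsBlock G k X) (hk : sepOrder p < k) :
    ¬X ⊆ p.1 ∩ p.2 := fun h =>
  absurd ((Set.ncard_le_ncard h).trans_lt hk) hX.1.not_gt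

lemma IsBlock.proper_of_subset (hX : IsBlock G k X) (hk : sepOrder p < k) (hXp : X ⊆ p.2)
    (hne : (p.1 \ p.2).Nonempty) : ProperSep p := by
  obtain ⟨x, hx, hxp⟩ := Set.not_subset.1 (hX.not_subset_inter hk)
  exact ⟨hne, x, hXp hx, fun h => hxp ⟨h, hXp hx⟩⟩

lemma ncard_corner_add_ncard_corner_le (p q : Set V × Set V) :
    (p.1 ∩ q.1 ∩ (p.2 ∪ q.2)).ncard + ((p.1 ∪ q.1) ∩ (p.2 ∩ q.2)).ncard ≤
      sepOrder p + sepOrder q := by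
  rw [sepOrder, sepOrder, ← Set.ncard_union_add_ncard_inter (p.1 ∩ q.1 ∩ (p.2 ∪ q.2)),
    ← Set.ncard_union_add_ncard_inter (p.1 ∩ p.2)]
  refine add_le_add (Set.ncard_le_ncard fun v => ?_) (Set.ncard_le_ncard fun v => ?_) <;>
  · simp only [mem_union, mem_inter_iff]
    tauto

/-- The ends of an edge in a small corner with empty interior that
lie on different separators are not locally linked. -/
lemma not_locallyLinked (hp : IsSep G p) (hq : IsSep G q) (hpk : sepOrder p < k)
    (hqk : sepOrder q < k) (hcorner : ∀ v ∈ p.1, v ∈ q.1 → v ∈ p.2 ∨ v ∈ q.2)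
    (hsmall : (p.1 ∩ q.1 ∩ (p.2 ∪ q.2)).ncard + 2 ≤ k) {x y : V} (hxy : G.Adj x y)
    (hxp : x ∈ p.1 ∩ p.2) (hxq : x ∈ q.1 \ q.2) (hyp : y ∈ p.1 \ p.2) (hyq : y ∈ q.1 ∩ q.2) :
    ¬LocallyLinked G k x y := by
  have hxS : x ∈ p.1 ∩ q.1 ∩ (p.2 ∪ q.2) := ⟨⟨hxp.1, hxq.1⟩, Or.inl hxp.2⟩
  have hyS : y ∈ p.1 ∩ q.1 ∩ (p.2 ∪ q.2) := ⟨⟨hyp.1, hyq.1⟩, Or.inr hyq.2⟩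
  rintro (hcard | ⟨Ps, hpath, hlen, hdisj⟩ | ⟨Y, hY, hxY, hyY⟩)
  · have hsub : {z | G.Adj x z ∧ G.Adj y z} ∪ {x, y} ⊆ p.1 ∩ q.1 ∩ (p.2 ∪ q.2) := by
      rintro v (⟨hxv, hyv⟩ | rfl | rfl)
      · have h1 := hp.mem_of_adj hyp.1 hyp.2 hyv
        have h2 := hq.mem_of_adj hxq.1 hxq.2 hxv
        exact ⟨⟨h1, h2⟩, hcorner v h1 h2⟩
      · exact hxS
      · exact hyS
    have hd : Disjoint {z | G.Adj x z ∧ G.Adj y z} {x, y} := by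
      rw [Set.disjoint_left]
      rintro v ⟨hxv, hyv⟩ (rfl | rfl)
      exacts [hxv.ne rfl, hyv.ne rfl]
    have := Set.ncard_le_ncard hsub
    rw [Set.ncard_union_eq hd, Set.ncard_pair hxy.ne] at this
    omega
  · have h1 := card_paths_add_two_le hxy.ne Ps hdisj (S := q.1 ∩ (q.2 ∪ p.1 ∩ p.2))
      ⟨hxq.1, Or.inr hxp⟩ ⟨hyq.1, Or.inl hyq.2⟩ fun i =>
        exists_inner_vertex hp hq hcorner hxq hyp hyq.2 (Ps i) (hpath i) (hlen i)
    have h2 := card_paths_add_two_le hxy.ne Ps hdisj (S := p.1 ∩ (p.2 ∪ q.1 ∩ q.2))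
      ⟨hxp.1, Or.inl hxp.2⟩ ⟨hyp.1, Or.inr hyq⟩ fun i => by
        obtain ⟨v, hv, hvy, hvx, hvS⟩ := exists_inner_vertex hq hp
          (fun v h h' => (hcorner v h' h).symm) hyp hxq hxp.2 (Ps i).reverse
          (hpath i).reverse (by simpa using hlen i)
        exact ⟨v, by simpa using hv, hvx, hvy, hvS⟩
    have h3 : (q.1 ∩ (q.2 ∪ p.1 ∩ p.2)).ncard + (p.1 ∩ (p.2 ∪ q.1 ∩ q.2)).ncard ≤
        sepOrder p + sepOrder q + (p.1 ∩ q.1 ∩ (p.2 ∪ q.2)).ncard := by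
      rw [← Set.ncard_union_add_ncard_inter]
      refine add_le_add ((Set.ncard_le_ncard fun v => ?_).trans (Set.ncard_union_le _ _))
        (Set.ncard_le_ncard fun v => ?_) <;>
      · simp only [mem_union, mem_inter_iff]
        tauto
    omega
  · have h1 := (hY.2.1 p hp hpk).resolve_right fun h => hyp.2 (h hyY)
    have h2 := (hY.2.1 q hq hqk).resolve_right fun h => hxq.2 (h hxY)
    have hsub : Y ⊆ p.1 ∩ q.1 ∩ (p.2 ∪ q.2) := fun v hv =>
      ⟨⟨h1 hv, h2 hv⟩, hcorner v (h1 hv) (h2 hv)⟩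
    have := Set.ncard_le_ncard hsub
    have := hY.1
    omega

lemma maxIn_blockProfile_subset (hconn : IsKConnected G (k - 1))
    (hlinked : ∀ x y, G.Adj x y → LocallyLinked G k x y) (hX : IsBlock G k X)
    (hp : MaxIn (blockProfile G k X) p) (hq : MaxIn (blockProfile G k X) q) (hne : p ≠ q) :
    p.1 ⊆ q.2 := by
  obtain ⟨⟨⟨hps, hpp, hpk⟩, hXp, -⟩, hpmax⟩ := hp
  obtain ⟨⟨⟨hqs, hqp, hqk⟩, hXq, -⟩, hqmax⟩ := hq
  have hlarge : k ≤ ((p.1 ∪ q.1) ∩ (p.2 ∩ q.2)).ncard := by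
    by_contra! hlt
    have hs : IsSep G (p.1 ∪ q.1, p.2 ∩ q.2) := (hps.swap.corner hqs.swap).swap
    have hX2 : X ⊆ p.2 ∩ q.2 := fun v hv => ⟨hXp hv, hXq hv⟩
    have hmem : (p.1 ∪ q.1, p.2 ∩ q.2) ∈ blockProfile G k X :=
      ⟨⟨hs, hX.proper_of_subset hlt hX2 (hpp.1.mono fun v hv => ⟨Or.inl hv.1, fun h => hv.2 h.1⟩),
        hlt⟩, hX2, fun h => hX.not_subset_inter (p := (p.1 ∪ q.1, p.2 ∩ q.2)) hlt
          fun v hv => ⟨h hv, hX2 hv⟩⟩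
    exact hne ((hpmax _ hmem ⟨subset_union_left, inter_subset_left⟩).symm.trans
      (hqmax _ hmem ⟨subset_union_right, inter_subset_right⟩))
  have hsmall : (p.1 ∩ q.1 ∩ (p.2 ∪ q.2)).ncard + 2 ≤ k := by
    have := ncard_corner_add_ncard_corner_le p q
    omega
  have hcorner : ∀ v ∈ p.1, v ∈ q.1 → v ∈ p.2 ∨ v ∈ q.2 := by
    intro v hvp hvq
    by_contra hv
    have : k - 1 ≤ (p.1 ∩ q.1 ∩ (p.2 ∪ q.2)).ncard :=
      hconn.le_sepOrder (hps.corner hqs) ⟨⟨v, ⟨hvp, hvq⟩, hv⟩,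
        hpp.2.mono fun u hu => ⟨Or.inl hu.1, fun h => hu.2 h.1⟩⟩
    omega
  intro x hxp
  by_contra hxq
  have hxq1 := (hqs.mem_or x).resolve_right hxq
  have hxp2 := (hcorner x hxp hxq1).resolve_right hxq
  obtain ⟨y, hy, hxy⟩ := hconn.exists_adj hps hpp hpk ⟨hxp, hxp2⟩
  have hyq1 := hqs.mem_of_adj hxq1 hxq hxy
  exact not_locallyLinked hps hqs hpk hqk hcorner hsmall hxy ⟨hxp, hxp2⟩ ⟨hxq1, hxq⟩ hy
    ⟨hyq1, (hcorner y hy.1 hyq1).resolve_left hy.2⟩ (hlinked x y hxy)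

lemma exists_maxIn_blockProfile (hX : IsBlock G k X) {v : V} (hv : v ∉ X) :
    ∃ q, MaxIn (blockProfile G k X) q ∧ v ∉ q.2 := by
  have hsep : ¬Inseparable' G k (insert v X) := fun h =>
    hv (hX.2.2 _ h (subset_insert v X) ▸ mem_insert v X)
  simp only [Inseparable', not_forall, not_or] at hsep
  obtain ⟨p, hp, hpk, h1, h2⟩ := hsep
  have key : ∀ p : Set V × Set V, IsSep G p → sepOrder p < k → X ⊆ p.2 →
      ¬insert v X ⊆ p.2 → ∃ q, MaxIn (blockProfile G k X) q ∧ v ∉ q.2 := by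
    intro p hp hpk hXp hvX
    have hvp : v ∉ p.2 := fun h => hvX (insert_subset h hXp)
    have hmem : p ∈ blockProfile G k X :=
      ⟨⟨hp, hX.proper_of_subset hpk hXp ⟨v, (hp.mem_or v).resolve_right hvp, hvp⟩, hpk⟩, hXp,
        fun h => hX.not_subset_inter hpk fun u hu => ⟨h hu, hXp hu⟩⟩
    obtain ⟨q, hq, hpq⟩ := exists_maxIn _ hmem
    exact ⟨q, hq, fun h => hvp (hpq.2 h)⟩
  rcases hX.2.1 p hp hpk with h | h
  · exact key p.swap hp.swap (sepOrder_swap p ▸ hpk) h h1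
  · exact key p hp hpk h h2

lemma exists_isPetal (hconn : IsKConnected G (k - 1))
    (hlinked : ∀ x y, G.Adj x y → LocallyLinked G k x y) (hX : IsBlock G k X) {v : V}
    (hv : v ∉ X) : ∃ p, IsPetal G k X p ∧ v ∉ p.2 := by
  obtain ⟨q, hq, hvq⟩ := exists_maxIn_blockProfile hX hv
  obtain ⟨⟨hqs, hqp, hqk⟩, hXq, -⟩ := hq.1
  have hqX : q.1 ∩ q.2 ⊆ X := by
    intro w hw
    by_contra hwX
    obtain ⟨r, hr, hwr⟩ := exists_maxIn_blockProfile hX hwX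
    exact hwr (maxIn_blockProfile_subset hconn hlinked hX hq hr (fun h => hwr (h ▸ hw.2)) hw.1)
  let R : V → V → Prop := fun a b => G.Adj a b ∧ b ∉ X
  let K : Set V := {w | Relation.ReflTransGen R v w}
  have hK : ∀ a ∈ K, a ∈ q.1 \ q.2 ∧ a ∉ X := by
    intro a ha
    induction ha with
    | refl => exact ⟨⟨(hqs.mem_or v).resolve_right hvq, hvq⟩, hv⟩
    | tail _ hbc ih =>
      have := hqs.mem_of_adj ih.1.1 ih.1.2 hbc.1
      exact ⟨⟨this, fun h => hbc.2 (hqX ⟨this, h⟩)⟩, hbc.2⟩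
  have hnbr : ∀ a ∈ K, ∀ b, G.Adj a b → b ∉ K → b ∈ q.1 ∩ q.2 := by
    intro a ha b hab hb
    have hbX : b ∈ X := by
      by_contra hbX
      exact hb (ha.tail ⟨hab, hbX⟩)
    exact ⟨hqs.mem_of_adj (hK a ha).1.1 (hK a ha).1.2 hab, hXq hbX⟩
  let p : Set V × Set V := (K ∪ {b | ∃ a ∈ K, G.Adj b a}, Kᶜ)
  have hpK : p.1 \ p.2 = K := by
    ext b
    simp only [p, mem_sdiff, mem_union, mem_compl_iff, not_not]
    tauto
  have hpq : p.1 ∩ p.2 ⊆ q.1 ∩ q.2 := by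
    rintro b ⟨hb | ⟨a, ha, hab⟩, hbK⟩
    · exact absurd hb hbK
    · exact hnbr a ha b hab.symm hbK
  refine ⟨p, ⟨?_, (Set.ncard_le_ncard hpq).trans_lt hqk, fun x hx hxK => (hK x hxK).2 hx,
    hpq.trans hqX, ?_, ?_, ?_⟩, fun h => h .refl⟩
  · refine isSep_of_mem (fun b => ?_) fun a b _ ha hab => Or.inr ⟨a, not_not.1 ha, hab.symm⟩
    by_cases hb : b ∈ K
    · exact Or.inl (Or.inl hb)
    · exact Or.inr hb
  · rw [hpK]
    rintro b ⟨hb | hb, hbK⟩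
    · exact absurd hb hbK
    · exact hb
  · rw [hpK]
    exact ⟨v, .refl⟩
  · rw [hpK]
    have hgen : ∀ S : Set V, v ∈ S → (∀ a ∈ S, ∀ b, a ∈ K → b ∈ K → G.Adj a b → b ∈ S) →
        K ⊆ S := by
      intro S hvS hS a ha
      induction ha with
      | refl => exact hvS
      | tail hb hbc ih => exact hS _ ih _ hb (hb.tail hbc) hbc.1
    rintro S ⟨s, hsS, hsK⟩ hS
    refine hgen S ?_ hS
    by_contra hvS
    exact hgen Sᶜ hvS (fun a ha b haK hbK hab hbS => ha (hS b hbS a hbK haK hab.symm)) hsK hsS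

/-! ### The petals of different blocks are nested -/

variable {Y : Set V}

lemma IsPetal.nested_of_subset_left_left (hconn : IsKConnected G (k - 1)) (hXb : IsBlock G k X)
    (hp : IsPetal G k X p) (hq : IsPetal G k Y q) (hX : X ⊆ q.1) (hY : Y ⊆ p.1) :
    Nested p q := by
  have hpq := hp.inter_subset.trans hX
  have hqp := hq.inter_subset.trans hY
  by_cases hne : ((p.2 ∩ q.2) \ (p.1 ∪ q.1)).Nonempty
  · have hle : k - 1 ≤ ((p.2 ∩ q.2) ∩ (p.1 ∪ q.1)).ncard :=
      hconn.le_sepOrder (hp.isSep.swap.corner hq.isSep.swap) ⟨hne,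
        hp.nonempty.mono fun v hv => ⟨Or.inl hv.1, fun h => hv.2 h.1⟩⟩
    have hsub1 : (p.2 ∩ q.2) ∩ (p.1 ∪ q.1) ⊆ p.1 ∩ p.2 := by
      rintro v ⟨⟨h1, h2⟩, h | h⟩
      exacts [⟨h, h1⟩, ⟨hqp ⟨h, h2⟩, h1⟩]
    have hsub2 : (p.2 ∩ q.2) ∩ (p.1 ∪ q.1) ⊆ q.1 ∩ q.2 := by
      rintro v ⟨⟨h1, h2⟩, h | h⟩
      exacts [⟨hpq ⟨h, h1⟩, h2⟩, ⟨h, h2⟩]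
    have hpk : (p.1 ∩ p.2).ncard < k := hp.order_lt
    have hqk : (q.1 ∩ q.2).ncard < k := hq.order_lt
    have heq : p.1 ∩ p.2 = q.1 ∩ q.2 :=
      (Set.eq_of_subset_of_ncard_le hsub1 (by omega)).symm.trans
        (Set.eq_of_subset_of_ncard_le hsub2 (by omega))
    obtain ⟨x, hxX, hxq⟩ := Set.not_subset.1 (hXb.not_subset_inter hq.order_lt)
    have hx1 := hX hxX
    rcases hq.subset_or hp.isSep fun v hv hvp => hv.2 (heq ▸ hvp : v ∈ q.1 ∩ q.2).2 with h | h
    · exact absurd (hp.subset_right hxX) (h ⟨hx1, fun h => hxq ⟨hx1, h⟩⟩).2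
    · refine Or.inr (Or.inr (Or.inl ⟨fun v hv => ?_, fun v hv => ?_⟩))
      · by_contra hv2
        exact (h ⟨(hq.isSep.mem_or v).resolve_right hv2, hv2⟩).2 hv
      · by_cases hv2 : v ∈ q.2
        · exact (heq ▸ (⟨hv, hv2⟩ : v ∈ q.1 ∩ q.2) : v ∈ p.1 ∩ p.2).2
        · exact (h ⟨hv, hv2⟩).1
  · have hempty : ∀ v ∈ p.2, v ∈ q.2 → v ∈ p.1 ∪ q.1 := by
      intro v h1 h2
      by_contra h
      exact hne ⟨v, ⟨h1, h2⟩, h⟩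
    refine Or.inr (Or.inr (Or.inr ⟨fun v hv => ?_, fun v hv => ?_⟩))
    · by_contra hv2
      rcases hempty v ((hp.isSep.mem_or v).resolve_left hv2) hv with h | h
      exacts [hv2 h, hv2 (hqp ⟨h, hv⟩)]
    · by_contra hv2
      rcases hempty v hv ((hq.isSep.mem_or v).resolve_left hv2) with h | h
      exacts [hv2 (hpq ⟨h, hv⟩), hv2 h]

lemma IsPetal.nested (hconn : IsKConnected G (k - 1)) (hX : IsBlock G k X) (hY : IsBlock G k Y)
    (hp : IsPetal G k X p) (hq : IsPetal G k Y q) : Nested p q := by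
  rcases hX.2.1 q hq.isSep hq.order_lt with h | h <;>
    rcases hY.2.1 p hp.isSep hp.order_lt with h' | h'
  · exact hp.nested_of_subset_left_left hconn hX hq h h'
  · exact (hq.nested_of_subset_left hp h' h).symm
  · exact hp.nested_of_subset_left hq h h'
  · exact hp.nested_of_subset_right hq h h'

lemma nestedSystem_petalSystem (hconn : IsKConnected G (k - 1)) :
    NestedSystem (petalSystem G k) := by
  have key : ∀ p X, IsBlock G k X → IsPetal G k X p → ∀ q ∈ petalSystem G k, Nested p q := by
    rintro p X hX hp q ⟨Y, hY, hq | hq⟩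
    · exact hp.nested hconn hX hY hq
    · exact (hp.nested hconn hX hY hq).symm.swap_left.symm
  rintro p ⟨X, hX, hp | hp⟩ q hq
  · exact key p X hX hp q hq
  · exact (key _ X hX hp q hq).swap_left

/-- The orientation of the petal system towards a block. -/
lemma blockOrientation (hX : IsBlock G k X) :
    IsOrientation (petalSystem G k) {p ∈ petalSystem G k | X ⊆ p.2} ∧
      Consistent {p ∈ petalSystem G k | X ⊆ p.2} := by
  refine ⟨⟨fun p hp => hp.1, fun p hp => ⟨fun h h' => ?_, fun h => ⟨hp, ?_⟩⟩⟩, ?_⟩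
  · exact hX.not_subset_inter (sepOrder_lt_of_mem_petalSystem hp) fun v hv => ⟨h'.2 hv, h.2 hv⟩
  · exact (hX.2.1 p (isSep_of_mem_petalSystem hp) (sepOrder_lt_of_mem_petalSystem hp)).resolve_left
      fun h' => h ⟨swap_mem_petalSystem hp, h'⟩
  · intro p hp q hq _ hle
    exact hX.not_subset_inter (sepOrder_lt_of_mem_petalSystem hp.1)
      fun v hv => ⟨hle.1 (hq.2 hv), hp.2 hv⟩

lemma nonempty_orientations_petalSystem : Nonempty (Orientations (petalSystem G k)) := by
  by_cases h : ∃ X, IsBlock G k X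
  · obtain ⟨X, hX⟩ := h
    exact ⟨⟨_, blockOrientation hX⟩⟩
  · refine ⟨⟨∅, ⟨empty_subset _, ?_⟩, fun p hp => hp.elim⟩⟩
    rintro p ⟨X, hX, -⟩
    exact absurd ⟨X, hX⟩ h

lemma orientationPart_eq_of_block_subset (hconn : IsKConnected G (k - 1))
    (hlinked : ∀ x y, G.Adj x y → LocallyLinked G k x y)
    (e : ι ≃ Orientations (petalSystem G k)) (hX : IsBlock G k X) {t : ι}
    (ht : X ⊆ orientationPart e t) : orientationPart e t = X := by
  refine Subset.antisymm (fun v hv => ?_) ht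
  by_contra hvX
  obtain ⟨p, hp, hvp⟩ := exists_isPetal hconn hlinked hX hvX
  have hpN : p ∈ petalSystem G k := ⟨X, hX, Or.inl hp⟩
  refine hvp (hv p ?_)
  by_contra hpt
  exact hX.not_subset_inter hp.order_lt fun x hx =>
    ⟨ht hx _ ((e t).2.1.swap_mem hpN hpt), hp.subset_right hx⟩

end Profiles

/-! ### Invariance under automorphisms -/

section Invariance

variable {G : SimpleGraph V} {k : ℕ} {p : Set V × Set V} {X : Set V}

lemma sepOrder_sepMap (φ : G ≃g G) (p : Set V × Set V) : sepOrder (sepMap φ p) = sepOrder p := by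
  rw [sepOrder, sepMap, ← Set.image_inter φ.injective, Set.ncard_image_of_injective _ φ.injective,
    sepOrder]

lemma mem_image_iso (φ : G ≃g G) (v : V) (S : Set V) : φ v ∈ φ '' S ↔ v ∈ S :=
  φ.injective.mem_set_image

lemma IsSep.sepMap (h : IsSep G p) (φ : G ≃g G) : IsSep G (sepMap φ p) := by
  refine isSep_of_mem (φ.surjective.forall.2 fun v => ?_)
    (φ.surjective.forall₂.2 fun u v => ?_)
  · simpa only [CanonicalTD.sepMap, mem_image_iso] using h.mem_or v
  · simp only [CanonicalTD.sepMap, mem_image_iso, φ.map_adj_iff]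
    exact h.mem_of_adj

lemma Inseparable'.image (h : Inseparable' G k X) (φ : G ≃g G) : Inseparable' G k (φ '' X) := by
  intro p hp hpk
  obtain ⟨q, rfl⟩ : ∃ q, sepMap φ q = p := ⟨_, sepMap_sepMap_symm φ p⟩
  have hq : IsSep G q := sepMap_symm_sepMap φ q ▸ hp.sepMap φ.symm
  exact (h q hq (sepOrder_sepMap φ q ▸ hpk)).imp (Set.image_mono ·) (Set.image_mono ·)

lemma IsBlock.image (h : IsBlock G k X) (φ : G ≃g G) : IsBlock G k (φ '' X) := by
  refine ⟨by rw [Set.ncard_image_of_injective _ φ.injective]; exact h.1, h.2.1.image φ,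
    fun Y hY hXY => ?_⟩
  have hback : φ.symm '' Y = X := by
    refine h.2.2 _ (hY.image φ.symm) fun x hx => ?_
    exact ⟨φ x, hXY ⟨x, hx, rfl⟩, φ.symm_apply_apply x⟩
  rw [← hback]
  simp [Set.image_image]

lemma IsPetal.sepMap (h : IsPetal G k X p) (φ : G ≃g G) :
    IsPetal G k (φ '' X) (sepMap φ p) := by
  have hdiff : (CanonicalTD.sepMap φ p).1 \ (CanonicalTD.sepMap φ p).2 = φ '' (p.1 \ p.2) :=
    (Set.image_sdiff φ.injective _ _).symm
  have hinter : (CanonicalTD.sepMap φ p).1 ∩ (CanonicalTD.sepMap φ p).2 = φ '' (p.1 ∩ p.2) :=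
    (Set.image_inter φ.injective).symm
  refine ⟨h.isSep.sepMap φ, sepOrder_sepMap φ p ▸ h.order_lt, Set.image_mono h.subset_right,
    ?_, ?_, ?_, fun S hne hS => ?_⟩
  · rw [hinter]
    exact Set.image_mono h.inter_subset
  · rw [hinter, hdiff]
    rintro _ ⟨v, hv, rfl⟩
    obtain ⟨a, ha, hva⟩ := h.exists_adj v hv
    exact ⟨φ a, ⟨a, ha, rfl⟩, φ.map_adj_iff.2 hva⟩
  · rw [hdiff]
    exact h.nonempty.image φ
  · rw [hdiff] at hne hS ⊢
    rw [Set.image_subset_iff]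
    obtain ⟨_, hsS, s, hs, rfl⟩ := hne
    refine h.connected _ ⟨s, hsS, hs⟩ fun a ha b haK hbK hab => ?_
    exact hS _ ha _ ⟨a, haK, rfl⟩ ⟨b, hbK, rfl⟩ (φ.map_adj_iff.2 hab)

lemma sepMap_mem_petalSystem (φ : G ≃g G) (hp : p ∈ petalSystem G k) :
    sepMap φ p ∈ petalSystem G k := by
  obtain ⟨X, hX, h⟩ := hp
  exact ⟨φ '' X, hX.image φ, h.imp (·.sepMap φ) (·.sepMap φ)⟩

end Invariance

/-- Theorem 3.4: under the stated local conditions on adjacent vertex pairs of a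
`(k-1)`-connected graph, `G` has a canonical tree-decomposition of adhesion `< k` in which
every part containing a `k`-block is a `k`-block; in particular distinct `k`-blocks lie in
different parts. -/
theorem stmt_10 {V : Type*} [Fintype V] (G : SimpleGraph V) (k : ℕ)
    (hconn : IsKConnected G (k - 1))
    (hpairs : ∀ x y : V, G.Adj x y →
      (k - 3 ≤ {z : V | G.Adj x z ∧ G.Adj y z}.ncard) ∨
      (∃ Ps : Fin (3 * (k - 2) / 2) → G.Walk x y,
        (∀ i, (Ps i).IsPath) ∧ (∀ i, 2 ≤ (Ps i).length) ∧
        ∀ i j, i ≠ j → ∀ v ∈ (Ps i).support, v ∈ (Ps j).support → v = x ∨ v = y) ∨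
      (∃ X : Set V, IsBlock G k X ∧ x ∈ X ∧ y ∈ X)) :
    ∃ (ι : Type) (_ : Fintype ι) (T : SimpleGraph ι) (Vt : ι → Set V),
      IsTreeDecomp G T Vt ∧ Canonical G T Vt ∧ AdhesionLt T Vt k ∧
      (∀ t : ι, (∃ X : Set V, IsBlock G k X ∧ X ⊆ Vt t) → IsBlock G k (Vt t)) ∧
      (∀ (X X' : Set V) (t : ι), IsBlock G k X → IsBlock G k X' → X ≠ X' →
        X ⊆ Vt t → ¬X' ⊆ Vt t) := by
  classical
  obtain ⟨n, ⟨f⟩⟩ := Finite.exists_equiv_fin (Orientations (petalSystem G k))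
  have : Nonempty (Fin n) := f.nonempty_congr.1 nonempty_orientations_petalSystem
  have hpart := fun (X : Set V) (t : Fin n) (hX : IsBlock G k X) =>
    orientationPart_eq_of_block_subset hconn hpairs f.symm hX (t := t)
  refine ⟨Fin n, inferInstance, orientationTree f.symm, orientationPart f.symm,
    orientationTree_isTreeDecomp (fun _ => swap_mem_petalSystem)
      (fun _ => isSep_of_mem_petalSystem) (nestedSystem_petalSystem hconn),
    orientationTree_canonical f.symm fun φ _ => sepMap_mem_petalSystem φ,
    orientationTree_adhesionLt fun _ => sepOrder_lt_of_mem_petalSystem, ?_, ?_⟩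
  · rintro t ⟨X, hX, hXt⟩
    exact (hpart X t hX hXt).symm ▸ hX
  · intro X X' t hX hX' hne hXt hXt'
    exact hne ((hpart X t hX hXt).symm.trans (hpart X' t hX' hXt'))

end CanonicalTD
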